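/- Let U ⊆ ℝ² be open and let A, Â : U → O(4,2) be smooth maps with θ = A⁻¹dA, θ̂ = Â⁻¹dÂ, and 0-th columns A₀, Â₀. Assume A and Â are second order frame fields: θ³₀ = θ⁴₀ = 0, the forms θ¹₀, θ²₀ are pointwise linearly independent, and the trace conditions θ³₁∧θ²₀ + θ¹₀∧θ³₂ = 0 and θ⁴₁∧θ²₀ + θ¹₀∧θ⁴₂ = 0 hold (and the same conditions for θ̂). Then the following are equivalent: (i) θ̂¹₀ = θ¹₀, θ̂²₀ = θ²₀, θ̂²₁ = θ²₁, θ̂⁰₀ = θ⁰₀, and θ̂ᵃᵢ = θᵃᵢ for a = 3,4 and i = 1,2; (ii) for every p₀ ∈ U there exist ρ₀ ∈ ℝ, a linear form ρ₁ on ℝ², and a symmetric bilinear form ρ₂ on ℝ² such that, setting D = Â(p₀)·A(p₀)⁻¹ and A′₀ = D·A₀ : U → ℝ⁶, one has Â₀(p₀) = ρ₀A′₀(p₀), dÂ₀|_{p₀}(v) = ρ₁(v)A′₀(p₀) + ρ₀dA′₀|_{p₀}(v), and D²Â₀|_{p₀}(v,v) = ρ₂(v,v)A′₀(p₀) + 2ρ₁(v)dA′₀|_{p₀}(v)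 + ρ₀D²A′₀|_{p₀}(v,v) for all v ∈ ℝ², where D² denotes the second iterated Fréchet derivative. (Condition (ii) says that f̂ = [Â₀] and D·f, f = [A₀], have second order analytic contact at every point, i.e. f and f̂ are second order conformal deformations of each other.) -/

import Mathlib

open Matrix

noncomputable section

attribute [local instance] Matrix.normedAddCommGroup Matrix.normedSpace

abbrev Mat6 := Matrix (Fin 6) (Fin 6) ℝ

/-- Gram matrix of `⟨x,y⟩ = −(x⁰y⁵ + x⁵y⁰) + x¹y¹ + x²y² + x³y³ − x⁴y⁴` on `ℝ⁶`. -/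
def Gm : Mat6 :=
  !![0,0,0,0,0,-1; 0,1,0,0,0,0; 0,0,1,0,0,0; 0,0,0,1,0,0; 0,0,0,0,-1,0; -1,0,0,0,0,0]

def O42 (A : Mat6) : Prop := Aᵀ * Gm * A = Gm

/-- The pulled-back Maurer–Cartan form `θ = A⁻¹dA` at `p` on `v`. -/
def mcForm (A : ℝ × ℝ → Mat6) (p v : ℝ × ℝ) : Mat6 := (A p)⁻¹ * fderiv ℝ A p v

/-- `A` is a second order frame field on `U`:  `θ³₀ = θ⁴₀ = 0`, the forms `θ¹₀, θ²₀`
are pointwise linearly independent, and the trace conditions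
`θ³₁∧θ²₀ + θ¹₀∧θ³₂ = 0`, `θ⁴₁∧θ²₀ + θ¹₀∧θ⁴₂ = 0` hold. -/
def SecondOrderFrame (A : ℝ × ℝ → Mat6) (U : Set (ℝ × ℝ)) : Prop :=
  (∀ p ∈ U, ∀ v : ℝ × ℝ, mcForm A p v 3 0 = 0 ∧ mcForm A p v 4 0 = 0) ∧
  (∀ p ∈ U, ∀ c : ℝ × ℝ,
    (∀ v : ℝ × ℝ, c.1 * mcForm A p v 1 0 + c.2 * mcForm A p v 2 0 = 0) → c = 0) ∧
  (∀ p ∈ U, ∀ v w : ℝ × ℝ,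
    (mcForm A p v 3 1 * mcForm A p w 2 0 - mcForm A p w 3 1 * mcForm A p v 2 0) +
      (mcForm A p v 1 0 * mcForm A p w 3 2 - mcForm A p w 1 0 * mcForm A p v 3 2) = 0 ∧
    (mcForm A p v 4 1 * mcForm A p w 2 0 - mcForm A p w 4 1 * mcForm A p v 2 0) +
      (mcForm A p v 1 0 * mcForm A p w 4 2 - mcForm A p w 1 0 * mcForm A p v 4 2) = 0)

/-- The entry functional `X ↦ X k j` on matrices. -/
def entryCLM (k j : Fin 6) : Mat6 →L[ℝ] ℝ :=
  LinearMap.toContinuousLinearMap (Matrix.entryLinearMap ℝ ℝ k j)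

/-- The map sending a matrix `X` to the `0`-th column of `M * X`. -/
def colCLM (M : Mat6) : Mat6 →L[ℝ] (Fin 6 → ℝ) :=
  LinearMap.toContinuousLinearMap
    { toFun := fun X i => (M * X) i 0
      map_add' := fun X Y => by ext i; simp [Matrix.mul_add]
      map_smul' := fun c X => by ext i; simp }

/-- Matrix multiplication as a continuous bilinear map. -/
def mulCLM : Mat6 →L[ℝ] Mat6 →L[ℝ] Mat6 :=
  LinearMap.toContinuousLinearMap
    ((LinearMap.toContinuousLinearMap : (Mat6 →ₗ[ℝ] Mat6) ≃ₗ[ℝ] (Mat6 →L[ℝ] Mat6)).toLinearMap ∘ₗ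
      LinearMap.mul ℝ Mat6)

/-- Transposition as a continuous linear map. -/
def transposeCLM : Mat6 →L[ℝ] Mat6 :=
  LinearMap.toContinuousLinearMap (Matrix.transposeLinearEquiv (Fin 6) (Fin 6) ℝ ℝ).toLinearMap

section MatrixCalculus

variable {E : Type*} [NormedAddCommGroup E] [NormedSpace ℝ E] {X Y : E → Mat6} {p : E}

theorem DifferentiableAt.mat6_mul (hX : DifferentiableAt ℝ X p) (hY : DifferentiableAt ℝ Y p) :
    DifferentiableAt ℝ (fun q => X q * Y q) p :=
  (mulCLM.hasFDerivAt_of_bilinear hX.hasFDerivAt hY.hasFDerivAt).differentiableAt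

theorem fderiv_mat6_mul (hX : DifferentiableAt ℝ X p) (hY : DifferentiableAt ℝ Y p) (v : E) :
    fderiv ℝ (fun q => X q * Y q) p v = X p * fderiv ℝ Y p v + fderiv ℝ X p v * Y p := by
  have h : fderiv ℝ (fun q => X q * Y q) p = _ :=
    (mulCLM.hasFDerivAt_of_bilinear hX.hasFDerivAt hY.hasFDerivAt).fderiv
  rw [h]
  rfl

theorem DifferentiableAt.mat6_transpose (hX : DifferentiableAt ℝ X p) :
    DifferentiableAt ℝ (fun q => (X q)ᵀ) p :=
  (transposeCLM.hasFDerivAt.comp p hX.hasFDerivAt).differentiableAt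

theorem fderiv_mat6_transpose (hX : DifferentiableAt ℝ X p) (v : E) :
    fderiv ℝ (fun q => (X q)ᵀ) p v = (fderiv ℝ X p v)ᵀ := by
  have h : fderiv ℝ (fun q => (X q)ᵀ) p = _ :=
    (transposeCLM.hasFDerivAt.comp p hX.hasFDerivAt).fderiv
  rw [h]
  rfl

theorem fderiv_mat6_entry (hX : DifferentiableAt ℝ X p) (v : E) (k j : Fin 6) :
    fderiv ℝ (fun q => X q k j) p v = fderiv ℝ X p v k j := by
  have h : fderiv ℝ (fun q => X q k j) p = _ :=
    ((entryCLM k j).hasFDerivAt.comp p hX.hasFDerivAt).fderiv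
  rw [h]
  rfl

theorem fderiv_mat6_col (M : Mat6) (hX : DifferentiableAt ℝ X p) (v : E) :
    fderiv ℝ (fun q => fun i => (M * X q) i 0) p v = fun i => (M * fderiv ℝ X p v) i 0 := by
  have h : fderiv ℝ (fun q => fun i => (M * X q) i 0) p = _ :=
    ((colCLM M).hasFDerivAt.comp p hX.hasFDerivAt).fderiv
  rw [h]
  rfl

theorem iteratedFDeriv_two_mat6_col (M : Mat6) (hX : ContDiffAt ℝ 2 X p) (v w : E) :
    iteratedFDeriv ℝ 2 (fun q => fun i => (M * X q) i 0) p ![v, w] =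
      fun i => (M * fderiv ℝ (fderiv ℝ X) p v w) i 0 := by
  have h : iteratedFDeriv ℝ 2 (fun q => fun i => (M * X q) i 0) p = _ :=
    (colCLM M).iteratedFDeriv_comp_left hX le_rfl
  rw [h]
  exact congrArg (colCLM M) (iteratedFDeriv_two_apply X p ![v, w])

end MatrixCalculus

theorem Gm_mul_Gm : Gm * Gm = 1 := by
  ext i j
  rw [Matrix.mul_apply, Fin.sum_univ_six]
  fin_cases i <;> fin_cases j <;> simp [Gm]

namespace O42

variable {A : Mat6}

theorem inv_mul (h : O42 A) : (Gm * Aᵀ * Gm) * A = 1 := by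
  rw [Matrix.mul_assoc, Matrix.mul_assoc, ← Matrix.mul_assoc Aᵀ, show Aᵀ * Gm * A = Gm from h,
    Gm_mul_Gm]

theorem inv_eq (h : O42 A) : A⁻¹ = Gm * Aᵀ * Gm := Matrix.inv_eq_left_inv h.inv_mul

theorem isUnit_det (h : O42 A) : IsUnit A.det :=
  (Matrix.isUnit_iff_isUnit_det A).1 (IsUnit.of_mul_eq_one_right _ h.inv_mul)

end O42

section MaurerCartan

variable {A : ℝ × ℝ → Mat6} {U : Set (ℝ × ℝ)} {p : ℝ × ℝ}

theorem mcForm_add (v w : ℝ × ℝ) : mcForm A p (v + w) = mcForm A p v + mcForm A p w := by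
  simp [mcForm, Matrix.mul_add]

theorem mul_mcForm (h : O42 (A p)) (v : ℝ × ℝ) : A p * mcForm A p v = fderiv ℝ A p v := by
  rw [mcForm, Matrix.mul_nonsing_inv_cancel_left _ _ h.isUnit_det]

theorem differentiableAt_fderiv_apply (hA : ContDiffAt ℝ 2 A p) (w : ℝ × ℝ) :
    DifferentiableAt ℝ (fun q => fderiv ℝ A q w) p :=
  ((hA.fderiv_right (m := 1) (by norm_num)).differentiableAt (by norm_num)).clm_apply
    (differentiableAt_const w)

theorem differentiableAt_mcForm (hA : ContDiffAt ℝ 2 A p) (hO : ∀ᶠ q in nhds p, O42 (A q))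
    (w : ℝ × ℝ) : DifferentiableAt ℝ (fun q => mcForm A q w) p := by
  have hd : DifferentiableAt ℝ A p := hA.differentiableAt (by norm_num)
  refine DifferentiableAt.congr_of_eventuallyEq (f := fun q => Gm * (A q)ᵀ * Gm * fderiv ℝ A q w)
    ?_ (hO.mono fun q hq => by simp only [mcForm, hq.inv_eq])
  exact ((((differentiableAt_const Gm).mat6_mul hd.mat6_transpose).mat6_mul
    (differentiableAt_const Gm)).mat6_mul (differentiableAt_fderiv_apply hA w))

/-- The second derivative of a frame field, expressed in the frame itself. -/
def sndForm (A : ℝ × ℝ → Mat6) (p v w : ℝ × ℝ) : Mat6 :=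
  (A p)⁻¹ * fderiv ℝ (fderiv ℝ A) p v w

theorem sndForm_comm (hA : ContDiffAt ℝ 2 A p) (v w : ℝ × ℝ) :
    sndForm A p v w = sndForm A p w v := by
  exact congrArg ((A p)⁻¹ * ·) (hA.isSymmSndFDerivAt (by simp) v w)

theorem mul_sndForm (h : O42 (A p)) (v w : ℝ × ℝ) :
    A p * sndForm A p v w = fderiv ℝ (fderiv ℝ A) p v w := by
  rw [sndForm, Matrix.mul_nonsing_inv_cancel_left _ _ h.isUnit_det]

theorem sndForm_eq (hA : ContDiffAt ℝ 2 A p) (hO : ∀ᶠ q in nhds p, O42 (A q)) (v w : ℝ × ℝ) :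
    sndForm A p v w =
      mcForm A p v * mcForm A p w + fderiv ℝ (fun q => mcForm A q w) p v := by
  have hd : DifferentiableAt ℝ A p := hA.differentiableAt (by norm_num)
  have hp : O42 (A p) := hO.self_of_nhds
  have h1 : fderiv ℝ (fun q => fderiv ℝ A q w) p v = fderiv ℝ (fderiv ℝ A) p v w := by
    have hd' := (hA.fderiv_right (m := 1) (by norm_num)).differentiableAt (by norm_num)
    refine (DFunLike.congr_fun
      (hd'.hasFDerivAt.clm_apply (hasFDerivAt_const w p)).fderiv v).trans ?_
    simp
    rfl
  have h2 : (fun q => fderiv ℝ A q w) =ᶠ[nhds p] fun q => A q * mcForm A q w :=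
    hO.mono fun q hq => (mul_mcForm hq w).symm
  rw [sndForm, ← h1, h2.fderiv_eq, fderiv_mat6_mul hd (differentiableAt_mcForm hA hO w),
    Matrix.mul_add, Matrix.nonsing_inv_mul_cancel_left _ _ hp.isUnit_det, ← Matrix.mul_assoc,
    add_comm]
  rfl

theorem mcForm_skew (hA : DifferentiableAt ℝ A p) (hO : ∀ᶠ q in nhds p, O42 (A q))
    (v : ℝ × ℝ) : (mcForm A p v)ᵀ * Gm + Gm * mcForm A p v = 0 := by
  have hp : (A p)ᵀ * Gm * A p = Gm := hO.self_of_nhds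
  have h : (fun q => (A q)ᵀ * Gm * A q) =ᶠ[nhds p] fun _ => Gm := hO
  have h1 := DFunLike.congr_fun (h.fderiv_eq (𝕜 := ℝ)) v
  have hG := differentiableAt_const (𝕜 := ℝ) (x := p) Gm
  simp only [fderiv_mat6_mul (hA.mat6_transpose.mat6_mul hG) hA,
    fderiv_mat6_mul hA.mat6_transpose hG, fderiv_mat6_transpose hA, fderiv_fun_const,
    ← mul_mcForm hO.self_of_nhds, Matrix.transpose_mul] at h1
  have h2 : (A p)ᵀ * Gm * (A p * mcForm A p v) = Gm * mcForm A p v := by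
    rw [← Matrix.mul_assoc, hp]
  have h3 : (mcForm A p v)ᵀ * (A p)ᵀ * Gm * A p = (mcForm A p v)ᵀ * Gm := by
    rw [Matrix.mul_assoc, Matrix.mul_assoc, ← Matrix.mul_assoc _ Gm, hp]
  simpa [h2, h3, add_comm] using h1

theorem mcForm_relations (hA : DifferentiableAt ℝ A p) (hO : ∀ᶠ q in nhds p, O42 (A q))
    (v : ℝ × ℝ) :
    mcForm A p v 5 0 = 0 ∧ mcForm A p v 1 1 = 0 ∧ mcForm A p v 2 2 = 0 ∧
      mcForm A p v 1 2 = -mcForm A p v 2 1 ∧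
      mcForm A p v 5 1 = mcForm A p v 1 0 ∧ mcForm A p v 5 2 = mcForm A p v 2 0 := by
  have h := mcForm_skew hA hO v
  have e (i j : Fin 6) := congrFun (congrFun h i) j
  have e00 := e 0 0
  have e11 := e 1 1
  have e22 := e 2 2
  have e12 := e 1 2
  have e01 := e 0 1
  have e02 := e 0 2
  simp only [Matrix.add_apply, Matrix.mul_apply, Matrix.transpose_apply, Fin.sum_univ_six,
    Matrix.zero_apply] at e00 e11 e22 e12 e01 e02
  simp [Gm] at e00 e11 e22 e12 e01 e02
  refine ⟨?_, ?_, ?_, ?_, ?_, ?_⟩ <;> linarith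

end MaurerCartan

section Contact

variable {A Ah : ℝ × ℝ → Mat6} {p : ℝ × ℝ}

theorem mul_col_zero_eq_iff {B : Mat6} (hB : IsUnit B.det) (X Y : Mat6) :
    ((fun i => (B * X) i 0) = fun i => (B * Y) i 0) ↔ ∀ k, X k 0 = Y k 0 := by
  constructor
  · intro h k
    have h1 : (B⁻¹ * (B * X)) k 0 = (B⁻¹ * (B * Y)) k 0 := by
      rw [Matrix.mul_apply, Matrix.mul_apply]
      exact Finset.sum_congr rfl fun i _ => congrArg (B⁻¹ k i * ·) (congrFun h i)
    simpa only [Matrix.nonsing_inv_mul_cancel_left _ _ hB] using h1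
  · intro h
    ext i
    simp only [Matrix.mul_apply, h]

theorem secondOrderContact_iff (hA : ContDiffAt ℝ 2 A p) (hAh : ContDiffAt ℝ 2 Ah p)
    (hO : O42 (A p)) (hOh : O42 (Ah p)) (r₀ : ℝ) (r₁ r₂ : ℝ × ℝ → ℝ) :
    ((fun i => Ah p i 0) = r₀ • (fun i => ((Ah p * (A p)⁻¹) * A p) i 0) ∧
      (∀ v : ℝ × ℝ,
        fderiv ℝ (fun q => (fun i => Ah q i 0)) p v =
          r₁ v • (fun i => ((Ah p * (A p)⁻¹) * A p) i 0) +
          r₀ • fderiv ℝ (fun q => (fun i => ((Ah p * (A p)⁻¹) * A q) i 0)) p v) ∧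
      (∀ v : ℝ × ℝ,
        iteratedFDeriv ℝ 2 (fun q => (fun i => Ah q i 0)) p ![v, v] =
          r₂ v • (fun i => ((Ah p * (A p)⁻¹) * A p) i 0) +
          (2 * r₁ v) • fderiv ℝ (fun q => (fun i => ((Ah p * (A p)⁻¹) * A q) i 0)) p v +
          r₀ • iteratedFDeriv ℝ 2
            (fun q => (fun i => ((Ah p * (A p)⁻¹) * A q) i 0)) p ![v, v])) ↔
    r₀ = 1 ∧
      (∀ v k, mcForm Ah p v k 0 = r₁ v * (1 : Mat6) k 0 + r₀ * mcForm A p v k 0) ∧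
      (∀ v k, sndForm Ah p v v k 0 =
        r₂ v * (1 : Mat6) k 0 + 2 * r₁ v * mcForm A p v k 0 + r₀ * sndForm A p v v k 0) := by
  have hd : DifferentiableAt ℝ A p := hA.differentiableAt (by norm_num)
  have hdh : DifferentiableAt ℝ Ah p := hAh.differentiableAt (by norm_num)
  set B := Ah p with hB
  have hDA : B * (A p)⁻¹ * A p = B := Matrix.nonsing_inv_mul_cancel_right _ _ hO.isUnit_det
  have hone : (fun q => fun i => Ah q i 0) = fun q => fun i => (1 * Ah q) i 0 := by
    simp only [Matrix.one_mul]
  have hcol : ∀ (a b c : ℝ) (X Y Z : Mat6),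
      (a • (fun i => (B * X) i 0) + b • (fun i => (B * Y) i 0) + c • fun i => (B * Z) i 0) =
        fun i => (B * (a • X + b • Y + c • Z)) i 0 := by
    intro a b c X Y Z
    ext i
    simp [Matrix.mul_add]
  refine and_congr ?_ (and_congr (forall_congr' fun v => ?_) (forall_congr' fun v => ?_))
  · have h := hcol r₀ 0 0 1 0 0
    have h' := mul_col_zero_eq_iff hOh.isUnit_det 1 (r₀ • 1 + (0 : ℝ) • 0 + (0 : ℝ) • 0)
    rw [← h] at h'
    simp only [zero_smul, add_zero, Matrix.mul_one] at h'
    rw [hDA, h']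
    constructor
    · intro h
      simpa using (h 0).symm
    · rintro rfl k
      simp
  · have h := hcol (r₁ v) r₀ 0 1 (mcForm A p v) 0
    have h' := mul_col_zero_eq_iff hOh.isUnit_det (mcForm Ah p v)
      (r₁ v • 1 + r₀ • mcForm A p v + (0 : ℝ) • 0)
    rw [← h] at h'
    simp only [zero_smul, add_zero, Matrix.mul_one] at h'
    rw [hone, fderiv_mat6_col _ hdh, fderiv_mat6_col _ hd, ← mul_mcForm hO, ← mul_mcForm (A := Ah) hOh,
      ← Matrix.mul_assoc _ (A p), hDA, Matrix.one_mul, ← hB, h']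
    simp
  · have h := hcol (r₂ v) (2 * r₁ v) r₀ 1 (mcForm A p v) (sndForm A p v v)
    have h' := mul_col_zero_eq_iff hOh.isUnit_det (sndForm Ah p v v)
      (r₂ v • 1 + (2 * r₁ v) • mcForm A p v + r₀ • sndForm A p v v)
    rw [← h] at h'
    simp only [Matrix.mul_one] at h'
    rw [hone, iteratedFDeriv_two_mat6_col _ hAh, iteratedFDeriv_two_mat6_col _ hA,
      fderiv_mat6_col _ hd, ← mul_mcForm hO, ← mul_sndForm hO, ← mul_sndForm (A := Ah) hOh,
      ← Matrix.mul_assoc _ (A p), ← Matrix.mul_assoc _ (A p), hDA, Matrix.one_mul, ← hB, h']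
    simp

end Contact

/-- Two additive functions whose pairing with a coframe is symmetric and vanishes on the diagonal
are both zero. -/
theorem eq_zero_of_symm_of_diag {x y t₁ t₂ : ℝ × ℝ → ℝ}
    (hx : ∀ v w, x (v + w) = x v + x w) (hy : ∀ v w, y (v + w) = y v + y w)
    (h₁ : ∀ v w, t₁ (v + w) = t₁ v + t₁ w) (h₂ : ∀ v w, t₂ (v + w) = t₂ v + t₂ w)
    (hind : ∀ c : ℝ × ℝ, (∀ v, c.1 * t₁ v + c.2 * t₂ v = 0) → c = 0)
    (hsymm : ∀ v w, x v * t₁ w + y v * t₂ w = x w * t₁ v + y w * t₂ v)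
    (hdiag : ∀ v, x v * t₁ v + y v * t₂ v = 0) (v : ℝ × ℝ) : x v = 0 ∧ y v = 0 := by
  refine Prod.mk_eq_zero.1 (hind (x v, y v) fun w => ?_)
  have hvw := hdiag (v + w)
  rw [hx, hy, h₁, h₂] at hvw
  linarith [hdiag v, hdiag w, hsymm v w]

/-- A conformal rotation `r + δ J` that annihilates a coframe on the diagonal is zero. -/
theorem eq_zero_of_conformal_diag {r δ t₁ t₂ : ℝ × ℝ → ℝ}
    (hr : ∀ v w, r (v + w) = r v + r w) (hδ : ∀ v w, δ (v + w) = δ v + δ w)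
    (h₁ : ∀ v w, t₁ (v + w) = t₁ v + t₁ w) (h₂ : ∀ v w, t₂ (v + w) = t₂ v + t₂ w)
    (hind : ∀ c : ℝ × ℝ, (∀ v, c.1 * t₁ v + c.2 * t₂ v = 0) → c = 0)
    (e₁ : ∀ v, r v * t₁ v + δ v * t₂ v = 0) (e₂ : ∀ v, r v * t₂ v - δ v * t₁ v = 0)
    (v : ℝ × ℝ) : r v = 0 ∧ δ v = 0 := by
  by_cases h : t₁ v = 0 ∧ t₂ v = 0
  · refine Prod.mk_eq_zero.1 (hind (r v, δ v) fun w => ?_)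
    have hvw := e₁ (v + w)
    rw [hr, hδ, h₁, h₂, h.1, h.2] at hvw
    linarith [e₁ w]
  · have hpos : t₁ v ^ 2 + t₂ v ^ 2 ≠ 0 := fun h0 =>
      h ⟨by nlinarith [sq_nonneg (t₁ v), sq_nonneg (t₂ v)],
        by nlinarith [sq_nonneg (t₁ v), sq_nonneg (t₂ v)]⟩
    constructor
    · refine (mul_eq_zero.1 ?_).resolve_right hpos
      linear_combination t₁ v * e₁ v + t₂ v * e₂ v
    · refine (mul_eq_zero.1 ?_).resolve_right hpos
      linear_combination t₂ v * e₁ v - t₁ v * e₂ v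

section Frame

variable {A Ah : ℝ × ℝ → Mat6} {U : Set (ℝ × ℝ)} {p : ℝ × ℝ}

theorem sndForm_col_zero (hA : ContDiffAt ℝ 2 A p) (hO : ∀ᶠ q in nhds p, O42 (A q))
    (h2 : SecondOrderFrame A U) (hp : p ∈ U) (v w : ℝ × ℝ) (k : Fin 6) :
    sndForm A p v w k 0 =
      mcForm A p v k 0 * mcForm A p w 0 0 + mcForm A p v k 1 * mcForm A p w 1 0 +
        mcForm A p v k 2 * mcForm A p w 2 0 + fderiv ℝ (fun q => mcForm A q w k 0) p v := by
  rw [sndForm_eq hA hO, Matrix.add_apply, Matrix.mul_apply, Fin.sum_univ_six,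
    (h2.1 p hp w).1, (h2.1 p hp w).2, (mcForm_relations (hA.differentiableAt (by norm_num)) hO w).1,
    fderiv_mat6_entry (differentiableAt_mcForm hA hO w)]
  ring

theorem secondFundamental_symm (hU : IsOpen U) (hA : ContDiffAt ℝ 2 A p)
    (hO : ∀ᶠ q in nhds p, O42 (A q)) (h2 : SecondOrderFrame A U) (hp : p ∈ U) {a : Fin 6}
    (ha : a = 3 ∨ a = 4) (v w : ℝ × ℝ) :
    mcForm A p v a 1 * mcForm A p w 1 0 + mcForm A p v a 2 * mcForm A p w 2 0 =
      mcForm A p w a 1 * mcForm A p v 1 0 + mcForm A p w a 2 * mcForm A p v 2 0 := by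
  have h0 : ∀ q ∈ U, ∀ u, mcForm A q u a 0 = 0 := by
    rintro q hq u
    rcases ha with rfl | rfl
    exacts [(h2.1 q hq u).1, (h2.1 q hq u).2]
  have hd : ∀ u u', fderiv ℝ (fun q => mcForm A q u a 0) p u' = 0 := by
    intro u u'
    have h : (fun q => mcForm A q u a 0) =ᶠ[nhds p] fun _ => 0 :=
      (hU.eventually_mem hp).mono fun q hq => h0 q hq u
    rw [h.fderiv_eq]
    simp
  have h := congrFun (congrFun (sndForm_comm hA v w) a) 0
  rw [sndForm_col_zero hA hO h2 hp, sndForm_col_zero hA hO h2 hp, hd, hd, h0 p hp, h0 p hp] at h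
  linarith

end Frame

/-- for smooth second order frame fields `A, Â : U → O(4,2)`, the equality of
the Maurer–Cartan components `θ̂¹₀ = θ¹₀`, `θ̂²₀ = θ²₀`, `θ̂²₁ = θ²₁`, `θ̂⁰₀ = θ⁰₀`,
`θ̂ᵃᵢ = θᵃᵢ` (`a = 3,4`, `i = 1,2`) is equivalent to second order analytic contact,
at every point `p₀ ∈ U`, of `f̂ = [Â₀]` with the displaced surface `D·f`,
`D = Â(p₀)A(p₀)⁻¹`, i.e. to `f` and `f̂` being second order conformal deformations
of each other. -/
theorem second_order_deformation_iff
    (U : Set (ℝ × ℝ)) (hU : IsOpen U)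
    (A Ah : ℝ × ℝ → Mat6)
    (hA : ContDiffOn ℝ (⊤ : ℕ∞) A U) (hAh : ContDiffOn ℝ (⊤ : ℕ∞) Ah U)
    (hAO : ∀ p ∈ U, O42 (A p)) (hAhO : ∀ p ∈ U, O42 (Ah p))
    (hA2 : SecondOrderFrame A U) (hAh2 : SecondOrderFrame Ah U) :
    -- (i)
    (∀ p ∈ U, ∀ v : ℝ × ℝ,
        mcForm Ah p v 1 0 = mcForm A p v 1 0 ∧
        mcForm Ah p v 2 0 = mcForm A p v 2 0 ∧
        mcForm Ah p v 2 1 = mcForm A p v 2 1 ∧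
        mcForm Ah p v 0 0 = mcForm A p v 0 0 ∧
        mcForm Ah p v 3 1 = mcForm A p v 3 1 ∧
        mcForm Ah p v 3 2 = mcForm A p v 3 2 ∧
        mcForm Ah p v 4 1 = mcForm A p v 4 1 ∧
        mcForm Ah p v 4 2 = mcForm A p v 4 2)
      ↔
    -- (ii) second order analytic contact at every point with the displaced surface
    (∀ p₀ ∈ U, ∃ (ρ₀ : ℝ) (ρ₁ : ℝ × ℝ →ₗ[ℝ] ℝ)
        (ρ₂ : ℝ × ℝ →ₗ[ℝ] ℝ × ℝ →ₗ[ℝ] ℝ), (∀ v w : ℝ × ℝ, ρ₂ v w = ρ₂ w v) ∧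
      (fun i => Ah p₀ i 0) =
          ρ₀ • (fun i => ((Ah p₀ * (A p₀)⁻¹) * A p₀) i 0) ∧
      (∀ v : ℝ × ℝ,
        fderiv ℝ (fun p => (fun i => Ah p i 0)) p₀ v =
          ρ₁ v • (fun i => ((Ah p₀ * (A p₀)⁻¹) * A p₀) i 0) +
          ρ₀ • fderiv ℝ (fun p => (fun i => ((Ah p₀ * (A p₀)⁻¹) * A p) i 0)) p₀ v) ∧
      (∀ v : ℝ × ℝ,
        iteratedFDeriv ℝ 2 (fun p => (fun i => Ah p i 0)) p₀ ![v, v] =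
          ρ₂ v v • (fun i => ((Ah p₀ * (A p₀)⁻¹) * A p₀) i 0) +
          (2 * ρ₁ v) •
            fderiv ℝ (fun p => (fun i => ((Ah p₀ * (A p₀)⁻¹) * A p) i 0)) p₀ v +
          ρ₀ • iteratedFDeriv ℝ 2
            (fun p => (fun i => ((Ah p₀ * (A p₀)⁻¹) * A p) i 0)) p₀ ![v, v])) := by
  have hAc : ∀ p ∈ U, ContDiffAt ℝ 2 A p := fun p hp =>
    (hA.contDiffAt (hU.mem_nhds hp)).of_le (WithTop.coe_le_coe.2 (le_top (a := (2 : ℕ∞))))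
  have hAhc : ∀ p ∈ U, ContDiffAt ℝ 2 Ah p := fun p hp =>
    (hAh.contDiffAt (hU.mem_nhds hp)).of_le (WithTop.coe_le_coe.2 (le_top (a := (2 : ℕ∞))))
  have hOe : ∀ p ∈ U, ∀ᶠ q in nhds p, O42 (A q) := fun p hp =>
    (hU.eventually_mem hp).mono hAO
  have hOhe : ∀ p ∈ U, ∀ᶠ q in nhds p, O42 (Ah q) := fun p hp =>
    (hU.eventually_mem hp).mono hAhO
  have hrel : ∀ p (hp : p ∈ U) v, _ := fun p hp v =>
    mcForm_relations ((hAc p hp).differentiableAt (by norm_num)) (hOe p hp) v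
  have hrelh : ∀ p (hp : p ∈ U) v, _ := fun p hp v =>
    mcForm_relations ((hAhc p hp).differentiableAt (by norm_num)) (hOhe p hp) v
  have hderiv : ∀ k : Fin 6,
      (∀ p ∈ U, ∀ v, mcForm Ah p v k 0 = mcForm A p v k 0) → ∀ p ∈ U, ∀ v w,
        fderiv ℝ (fun q => mcForm Ah q w k 0) p v = fderiv ℝ (fun q => mcForm A q w k 0) p v := by
    intro k h p hp v w
    have he : (fun q => mcForm Ah q w k 0) =ᶠ[nhds p] fun q => mcForm A q w k 0 :=
      (hU.eventually_mem hp).mono fun q hq => h q hq w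
    rw [he.fderiv_eq]
  have hadd : ∀ (B : ℝ × ℝ → Mat6) p (i j : Fin 6) v w,
      mcForm B p (v + w) i j = mcForm B p v i j + mcForm B p w i j := fun B p i j v w => by
    rw [mcForm_add, Matrix.add_apply]
  constructor
  · intro h p hp
    have hcol : ∀ k : Fin 6, ∀ q ∈ U, ∀ v, mcForm Ah q v k 0 = mcForm A q v k 0 := by
      intro k q hq v
      obtain ⟨h10, h20, -, h00, -⟩ := h q hq v
      fin_cases k
      exacts [h00, h10, h20, (hAh2.1 q hq v).1.trans (hA2.1 q hq v).1.symm,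
        (hAh2.1 q hq v).2.trans (hA2.1 q hq v).2.symm,
        (hrelh q hq v).1.trans (hrel q hq v).1.symm]
    have hsnd : ∀ v w, ∀ k : Fin 6, k ≠ 0 → sndForm Ah p v w k 0 = sndForm A p v w k 0 := by
      intro v w k hk
      obtain ⟨h10, h20, h21, h00, h31, h32, h41, h42⟩ := h p hp v
      obtain ⟨-, r11, r22, r12, r51, r52⟩ := hrel p hp v
      obtain ⟨-, s11, s22, s12, s51, s52⟩ := hrelh p hp v
      rw [sndForm_col_zero (hAc p hp) (hOe p hp) hA2 hp,
        sndForm_col_zero (hAhc p hp) (hOhe p hp) hAh2 hp, hderiv k (hcol k) p hp v w,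
        hcol k p hp, hcol 0 p hp, hcol 1 p hp, hcol 2 p hp]
      have hk12 : mcForm Ah p v k 1 = mcForm A p v k 1 ∧
          mcForm Ah p v k 2 = mcForm A p v k 2 := by
        fin_cases k
        exacts [absurd rfl hk, ⟨s11.trans r11.symm, by simp [s12, r12, h21]⟩,
          ⟨h21, s22.trans r22.symm⟩, ⟨h31, h32⟩, ⟨h41, h42⟩,
          ⟨by simp [s51, r51, h10], by simp [s52, r52, h20]⟩]
      rw [hk12.1, hk12.2]
    refine ⟨1, 0, LinearMap.mk₂ ℝ (fun v w => sndForm Ah p v w 0 0 - sndForm A p v w 0 0)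
      ?_ ?_ ?_ ?_, ?_, (secondOrderContact_iff (hAc p hp) (hAhc p hp) (hAO p hp) (hAhO p hp) 1
        (fun v => (0 : ℝ × ℝ →ₗ[ℝ] ℝ) v) _).2 ⟨rfl, ?_, ?_⟩⟩
    · intro v v' w
      simp only [sndForm, map_add, _root_.add_apply, Matrix.mul_add, Matrix.add_apply]
      ring
    · intro c v w
      simp only [sndForm, map_smul, _root_.smul_apply, Matrix.mul_smul,
        Matrix.smul_apply, smul_sub]
    · intro v w w'
      simp only [sndForm, map_add, Matrix.mul_add, Matrix.add_apply]
      ring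
    · intro c v w
      simp only [sndForm, map_smul, Matrix.mul_smul, Matrix.smul_apply, smul_sub]
    · intro v w
      simp only [LinearMap.mk₂_apply]
      rw [sndForm_comm (hAhc p hp), sndForm_comm (hAc p hp)]
    · intro v k
      simp [hcol k p hp v]
    · intro v k
      by_cases hk : k = 0
      · subst hk
        simp
      · simp [hsnd v v k hk, hk]
  · intro h p hp v
    have hc : ∀ q ∈ U, ∃ r₁ : ℝ × ℝ →ₗ[ℝ] ℝ, ∃ r₂ : ℝ × ℝ → ℝ,
        (∀ u k, mcForm Ah q u k 0 = r₁ u * (1 : Mat6) k 0 + mcForm A q u k 0) ∧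
        (∀ u k, sndForm Ah q u u k 0 =
          r₂ u * (1 : Mat6) k 0 + 2 * r₁ u * mcForm A q u k 0 + sndForm A q u u k 0) := by
      intro q hq
      obtain ⟨r₀, r₁, r₂, -, hcontact⟩ := h q hq
      obtain ⟨rfl, h1, h2⟩ := (secondOrderContact_iff (hAc q hq) (hAhc q hq) (hAO q hq)
        (hAhO q hq) r₀ r₁ (fun u => r₂ u u)).1 hcontact
      simp only [one_mul] at h1 h2
      exact ⟨r₁, fun u => r₂ u u, h1, h2⟩
    have hcol : ∀ k : Fin 6, k ≠ 0 → ∀ q ∈ U, ∀ u, mcForm Ah q u k 0 = mcForm A q u k 0 := by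
      intro k hk q hq u
      obtain ⟨r₁, -, h1, -⟩ := hc q hq
      simp [h1 u k, hk]
    obtain ⟨r₁, r₂, h1, h2⟩ := hc p hp
    have h00 : ∀ u, mcForm Ah p u 0 0 = r₁ u + mcForm A p u 0 0 := fun u => by simp [h1 u 0]
    have hquad : ∀ u, ∀ k : Fin 6, k ≠ 0 →
        (mcForm Ah p u k 1 - mcForm A p u k 1) * mcForm A p u 1 0 +
          (mcForm Ah p u k 2 - mcForm A p u k 2) * mcForm A p u 2 0 =
        r₁ u * mcForm A p u k 0 := by
      intro u k hk
      have h := h2 u k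
      rw [sndForm_col_zero (hAc p hp) (hOe p hp) hA2 hp,
        sndForm_col_zero (hAhc p hp) (hOhe p hp) hAh2 hp, hderiv k (hcol k hk) p hp,
        hcol k hk p hp, hcol 1 (by decide) p hp, hcol 2 (by decide) p hp, h00,
        Matrix.one_apply_ne hk] at h
      linarith
    have hconf := eq_zero_of_conformal_diag (r := r₁)
      (δ := fun u => mcForm Ah p u 2 1 - mcForm A p u 2 1) (fun u w => map_add r₁ u w)
      (fun u w => by simp only [hadd]; ring) (hadd A p 1 0) (hadd A p 2 0) (hA2.2.1 p hp)
      (fun u => by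
        obtain ⟨-, r11, -, r12, -⟩ := hrel p hp u
        obtain ⟨-, s11, -, s12, -⟩ := hrelh p hp u
        have h := hquad u 1 (by decide)
        rw [r11, s11, r12, s12] at h
        linarith)
      (fun u => by
        obtain ⟨-, -, r22, -⟩ := hrel p hp u
        obtain ⟨-, -, s22, -⟩ := hrelh p hp u
        have h := hquad u 2 (by decide)
        rw [r22, s22] at h
        linarith)
    have hnormal : ∀ a : Fin 6, a = 3 ∨ a = 4 →
        mcForm Ah p v a 1 - mcForm A p v a 1 = 0 ∧ mcForm Ah p v a 2 - mcForm A p v a 2 = 0 := by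
      intro a ha
      have hk : a ≠ 0 := by rcases ha with rfl | rfl <;> decide
      refine eq_zero_of_symm_of_diag (x := fun u => mcForm Ah p u a 1 - mcForm A p u a 1)
        (y := fun u => mcForm Ah p u a 2 - mcForm A p u a 2)
        (fun u w => by simp only [hadd]; ring) (fun u w => by simp only [hadd]; ring)
        (hadd A p 1 0) (hadd A p 2 0) (hA2.2.1 p hp) (fun u w => ?_) (fun u => ?_) v
      · have hs := secondFundamental_symm hU (hAc p hp) (hOe p hp) hA2 hp ha u w
        have hsh := secondFundamental_symm hU (hAhc p hp) (hOhe p hp) hAh2 hp ha u w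
        simp only [hcol 1 (by decide) p hp, hcol 2 (by decide) p hp] at hsh
        linarith
      · simpa [(hconf u).1] using hquad u a hk
    obtain ⟨h31, h32⟩ := hnormal 3 (Or.inl rfl)
    obtain ⟨h41, h42⟩ := hnormal 4 (Or.inr rfl)
    exact ⟨hcol 1 (by decide) p hp v, hcol 2 (by decide) p hp v, sub_eq_zero.1 (hconf v).2,
      by rw [h00, (hconf v).1, zero_add], sub_eq_zero.1 h31, sub_eq_zero.1 h32,
      sub_eq_zero.1 h41, sub_eq_zero.1 h42⟩
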